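/- arXiv:2504.14380 — 3 statements merged into one kernel-verified Lean document; each statement's English description precedes it below -/
import Mathlib

section
/- Let G be a finite abelian group, α a normalized unitary 2-cocycle on G, ıα : G → Ĝ its slant product, and K_α = ker(ıα) its degeneracy. Then ıα induces a group isomorphism from the quotient group G/K_α onto the kernel of the restriction homomorphism Res : Ĝ → K̂_α. -/
/-- The restriction homomorphism `Ĝ → K̂` on Pontryagin duals, given by restricting a
character of `G` to the subgroup `K`. -/
noncomputable def restrictHom {G : Type*} [CommGroup G] (K : Subgroup G) :
    (G →* Circle) →* (K →* Circle) where
  toFun χ := χ.comp K.subtype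
  map_one' := by ext; rfl
  map_mul' _ _ := by ext; rfl

/-- A finite commutative group has as many characters with values in the circle as elements. -/
theorem card_monoidHom_circle (A : Type*) [CommGroup A] [Finite A] :
    Nat.card (A →* Circle) = Nat.card A := by
  rw [← CommGroup.card_monoidHom_of_hasEnoughRootsOfUnity A Circle]
  exact Nat.card_congr (toUnits.monoidHomCongrRight (M := A)).toEquiv

instance finite_monoidHom_circle (A : Type*) [CommGroup A] [Finite A] :
    Finite (A →* Circle) :=
  Nat.finite_of_card_ne_zero (card_monoidHom_circle A ▸ Nat.card_pos.ne')

theorem mem_ker_restrictHom_iff {G : Type*} [CommGroup G] (K : Subgroup G) (χ : G →* Circle) :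
    χ ∈ (restrictHom K).ker ↔ ∀ k ∈ K, χ k = 1 := by
  rw [MonoidHom.mem_ker, MonoidHom.ext_iff, Subtype.forall]
  rfl

theorem card_ker_restrictHom {G : Type*} [CommGroup G] [Finite G] (K : Subgroup G) :
    Nat.card (restrictHom K).ker = Nat.card (G ⧸ K) := by
  rw [← card_monoidHom_circle (G ⧸ K)]
  exact Nat.card_congr (MonoidHom.domRestrictHomKerEquiv Circle K).toEquiv

/-- A skew-symmetric pairing on a finite commutative group identifies the quotient by its radical
with the characters that are trivial on the radical. -/
theorem exists_mulEquiv_ker_restrictHom_of_skew {G : Type*} [CommGroup G] [Finite G]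
    (ι : G →* (G →* Circle)) (hskew : ∀ g h, ι g h = (ι h g)⁻¹) :
    ∃ e : (G ⧸ ι.ker) ≃* (restrictHom ι.ker).ker,
      ∀ g : G, ((e (QuotientGroup.mk g) : (restrictHom ι.ker).ker) : G →* Circle) = ι g := by
  have hmem (g : G) : ι g ∈ (restrictHom ι.ker).ker := by
    rw [mem_ker_restrictHom_iff]
    intro k hk
    rw [hskew, MonoidHom.mem_ker.mp hk, MonoidHom.one_apply, inv_one]
  let f : G ⧸ ι.ker →* (restrictHom ι.ker).ker :=
    (QuotientGroup.kerLift ι).codRestrict _ fun q ↦ QuotientGroup.induction_on q hmem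
  have hf : Function.Injective f := fun _ _ h ↦
    QuotientGroup.kerLift_injective ι (congrArg Subtype.val h)
  exact ⟨MulEquiv.ofBijective f ((Nat.bijective_iff_injective_and_card f).mpr
    ⟨hf, (card_ker_restrictHom ι.ker).symm⟩), fun _ ↦ rfl⟩


/-- For a finite abelian group `G`, a normalized unitary 2-cocycle `α` on `G`, and
the slant product `ι = ıα : G →* Ĝ` with degeneracy `K_α = ker ι`, the map `ι` induces a group
isomorphism `G ⧸ K_α ≃* ker (Res : Ĝ → K̂_α)`. -/
theorem slant_induces_iso_quotient_to_ker_restriction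
    {G : Type*} [CommGroup G] [Fintype G]
    (α : G → G → ℂ)
    (hunit : ∀ g h, ‖α g h‖ = 1)
    (hnorm : ∀ g, α g 1 = 1 ∧ α 1 g = 1)
    (hcoc : ∀ g h k, α g h * α (g * h) k = α g (h * k) * α h k)
    (ι : G →* (G →* Circle))
    (hι : ∀ g h, (ι g h : ℂ) = α g h / α h g) :
    ∃ e : (G ⧸ ι.ker) ≃* (restrictHom ι.ker).ker,
      ∀ g : G, ((e (QuotientGroup.mk g) : (restrictHom ι.ker).ker) : G →* Circle) = ι g := by
  refine exists_mulEquiv_ker_restrictHom_of_skew ι fun g h ↦ Circle.ext ?_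
  rw [Circle.coe_inv, hι, hι, inv_div]
end

section
/- Let G be a finite group, α a normalized unitary 2-cocycle on G, and λ : G → GL(|G|, ℂ) a unitary α-projective representation of degree |G| (i.e. λ(g)λ(h) = α(g,h)·λ(gh) with each λ(g) unitary) whose character satisfies trace(λ(g)) = |G| if g = 1 and trace(λ(g)) = 0 if g ≠ 1. Then λ is linearly equivalent to the left regular α-projective representation: there exists an invertible |G|×|G| matrix S with λ(g) = S⁻¹·L^α(g)·S for all g ∈ G. -/
open Matrix

/-- The left regular `α`-projective representation of a finite group `G`, acting on `ℂG`:
`(L^α g) h' h = α g h` if `h' = g * h` and `0` otherwise. -/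
def Lreg {G : Type*} [Group G] [DecidableEq G] (α : G → G → ℂ) (g : G) :
    Matrix G G ℂ :=
  fun h' h => if h' = g * h then α g h else 0

namespace Matrix

section Average

variable {K n G : Type*} [Field K] [Fintype n] [DecidableEq n] [Fintype G]

theorem nonsing_inv_mul_comm_of_intertwines {A B T : Matrix n n K} (hA : IsUnit A) (hB : IsUnit B)
    (h : A * T = T * B) : A⁻¹ * T = T * B⁻¹ := by
  rw [Matrix.isUnit_iff_isUnit_det] at hA hB
  calc A⁻¹ * T = A⁻¹ * (T * B) * B⁻¹ := by
        rw [Matrix.mul_assoc, Matrix.mul_assoc, Matrix.mul_nonsing_inv _ hB, Matrix.mul_one]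
    _ = T * B⁻¹ := by
        rw [← h, ← Matrix.mul_assoc, Matrix.nonsing_inv_mul _ hA, Matrix.one_mul]

/-- The unnormalized average `X ↦ ∑ g, ρ g * X * (σ g)⁻¹` over two families of matrices. -/
noncomputable def avg (ρ σ : G → Matrix n n K) : Matrix n n K →ₗ[K] Matrix n n K where
  toFun X := ∑ g, ρ g * X * (σ g)⁻¹
  map_add' X Y := by simp [mul_add, add_mul, Finset.sum_add_distrib]
  map_smul' c X := by simp [Finset.smul_sum]

/-- The compressed average `X ↦ ∑ g, ρ g * (Q * X * P) * (σ g)⁻¹`. -/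
noncomputable def compressedAvg (ρ σ : G → Matrix n n K) (Q P : Matrix n n K) :
    Matrix n n K →ₗ[K] Matrix n n K :=
  avg ρ σ ∘ₗ LinearMap.mulLeft K Q ∘ₗ LinearMap.mulRight K P

theorem avg_apply (ρ σ : G → Matrix n n K) (X : Matrix n n K) :
    avg ρ σ X = ∑ g, ρ g * X * (σ g)⁻¹ := rfl

theorem compressedAvg_apply (ρ σ : G → Matrix n n K) (Q P X : Matrix n n K) :
    compressedAvg ρ σ Q P X = avg ρ σ (Q * (X * P)) := rfl

theorem trace_eq_sum_single (f : Matrix n n K →ₗ[K] Matrix n n K) :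
    LinearMap.trace K _ f = ∑ p : n × n, f (Matrix.single p.1 p.2 1) p.1 p.2 := by
  rw [LinearMap.trace_eq_matrix_trace K (Matrix.stdBasis K n n)]
  simp only [Matrix.trace, Matrix.diag, LinearMap.toMatrix_apply]
  refine Finset.sum_congr rfl fun p _ => ?_
  obtain ⟨i, j⟩ := p
  rw [Matrix.stdBasis_eq_single]
  rfl

theorem trace_compressedAvg (ρ σ : G → Matrix n n K) (Q P : Matrix n n K) :
    LinearMap.trace K _ (compressedAvg ρ σ Q P) =
      ∑ g, (ρ g * Q).trace * (P * (σ g)⁻¹).trace := by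
  have key (A B : Matrix n n K) (i j : n) : (A * Matrix.single i j 1 * B : Matrix n n K) i j =
      A i i * B j j := by
    simp [Matrix.mul_apply, Matrix.single_apply, ite_and]
  simp only [trace_eq_sum_single, compressedAvg_apply, avg_apply, Matrix.sum_apply]
  rw [Finset.sum_comm]
  refine Finset.sum_congr rfl fun g _ => ?_
  have (i j : n) : (ρ g * (Q * (Matrix.single i j 1 * P)) * (σ g)⁻¹ : Matrix n n K) i j =
      (ρ g * Q) i i * (P * (σ g)⁻¹) j j := by
    rw [← key]
    simp only [Matrix.mul_assoc]
  simp only [this, Fintype.sum_prod_type, Matrix.trace, Matrix.diag, Finset.sum_mul_sum]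

theorem avg_of_intertwines {ρ σ : G → Matrix n n K} (hσ : ∀ g, IsUnit (σ g))
    {X : Matrix n n K} (hX : ∀ g, ρ g * X = X * σ g) :
    avg ρ σ X = (Fintype.card G : K) • X := by
  have (g : G) : ρ g * X * (σ g)⁻¹ = X := by
    rw [hX, Matrix.mul_assoc, Matrix.mul_nonsing_inv _ ((Matrix.isUnit_iff_isUnit_det _).1 (hσ g)),
      Matrix.mul_one]
  simp [avg_apply, this, Nat.cast_smul_eq_nsmul]

theorem avg_intertwines [Group G] {α : G → G → K}
    {ρ σ : G → Matrix n n K} (hσ : ∀ g, IsUnit (σ g))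
    (hρm : ∀ g h, ρ g * ρ h = α g h • ρ (g * h))
    (hσm : ∀ g h, σ g * σ h = α g h • σ (g * h)) (X : Matrix n n K) (h : G) :
    ρ h * avg ρ σ X = avg ρ σ X * σ h := by
  have hdet (g : G) : IsUnit (σ g).det := (Matrix.isUnit_iff_isUnit_det _).1 (hσ g)
  have inv (g : G) : α h g • (σ g)⁻¹ = (σ (h * g))⁻¹ * σ h := by
    have h1 : (σ (h * g))⁻¹ * (σ h * σ g) * (σ g)⁻¹ = (σ (h * g))⁻¹ * σ h := by
      rw [← Matrix.mul_assoc, Matrix.mul_assoc, Matrix.mul_nonsing_inv _ (hdet g), Matrix.mul_one]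
    rw [← h1, hσm, Matrix.mul_smul, Matrix.nonsing_inv_mul _ (hdet _), Matrix.smul_mul,
      Matrix.one_mul]
  rw [avg_apply, Finset.mul_sum, Finset.sum_mul]
  rw [← Equiv.sum_comp (Equiv.mulLeft h) fun g => ρ g * X * (σ g)⁻¹ * σ h]
  refine Finset.sum_congr rfl fun g _ => ?_
  simp only [Equiv.coe_mulLeft]
  rw [Matrix.mul_assoc _ _ (σ h), ← inv, ← Matrix.mul_assoc, ← Matrix.mul_assoc, hρm]
  simp

theorem mul_compressedAvg {ρ σ : G → Matrix n n K} {P Q : Matrix n n K} (hQ : Q * Q = Q)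
    (hQρ : ∀ g, ρ g * Q = Q * ρ g) (X : Matrix n n K) :
    Q * compressedAvg ρ σ Q P X = compressedAvg ρ σ Q P X := by
  rw [compressedAvg_apply, avg_apply, Finset.mul_sum]
  refine Finset.sum_congr rfl fun g _ => ?_
  rw [← Matrix.mul_assoc, ← Matrix.mul_assoc, ← hQρ, Matrix.mul_assoc (ρ g),
    ← Matrix.mul_assoc Q, hQ]

theorem compressedAvg_mul {ρ σ : G → Matrix n n K} (hσ : ∀ g, IsUnit (σ g)) {P Q : Matrix n n K}
    (hP : P * P = P) (hPσ : ∀ g, σ g * P = P * σ g) (X : Matrix n n K) :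
    compressedAvg ρ σ Q P X * P = compressedAvg ρ σ Q P X := by
  rw [compressedAvg_apply, avg_apply, Finset.sum_mul]
  refine Finset.sum_congr rfl fun g _ => ?_
  calc ρ g * (Q * (X * P)) * (σ g)⁻¹ * P = ρ g * (Q * X) * (P * ((σ g)⁻¹ * P)) := by
        simp only [Matrix.mul_assoc]
    _ = ρ g * (Q * (X * (P * P))) * (σ g)⁻¹ := by
        rw [nonsing_inv_mul_comm_of_intertwines (hσ g) (hσ g) (hPσ g)]
        simp only [← Matrix.mul_assoc]
    _ = _ := by rw [hP]

/-- Every square matrix over a field has a generalized inverse. -/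
theorem exists_mul_mul_eq_self (T : Matrix n n K) : ∃ R : Matrix n n K, T * R * T = T := by
  obtain ⟨s, hs⟩ := T.toLin'.rangeRestrict.exists_rightInverse_of_surjective
    (LinearMap.range_rangeRestrict _)
  obtain ⟨p, hp⟩ := (LinearMap.range T.toLin').subtype.exists_leftInverse_of_injective
    (Submodule.ker_subtype _)
  refine ⟨LinearMap.toMatrix' (s ∘ₗ p), Matrix.toLin'.injective (LinearMap.ext fun v => ?_)⟩
  have h1 (w) : T.toLin' (s w) = w := congrArg Subtype.val (LinearMap.congr_fun hs w)
  have h2 : p (T.toLin' v) = T.toLin'.rangeRestrict v :=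
    LinearMap.congr_fun hp (T.toLin'.rangeRestrict v)
  rw [Matrix.toLin'_mul, Matrix.toLin'_mul, Matrix.toLin'_toMatrix']
  simp only [LinearMap.comp_apply]
  rw [h2, h1]
  rfl

theorem exists_compressedAvg_ne_zero [CharZero K] [Group G] {α : G → G → K}
    {ρ σ : G → Matrix n n K} (hσ : ∀ g, IsUnit (σ g))
    (hσm : ∀ g h, σ g * σ h = α g h • σ (g * h)) {P Q : Matrix n n K}
    (hP : P * P = P) (hPσ : ∀ g, σ g * P = P * σ g)
    (htr : ∀ g, (ρ g * Q).trace = (σ g * P).trace) (hP0 : P ≠ 0) :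
    ∃ X, compressedAvg ρ σ Q P X ≠ 0 := by
  by_contra! h
  have hc : (Fintype.card G : K) ≠ 0 := Nat.cast_ne_zero.2 Fintype.card_ne_zero
  have h0 : LinearMap.trace K _ (compressedAvg σ σ P P) = 0 := by
    rw [trace_compressedAvg]
    simp_rw [← htr]
    rw [← trace_compressedAvg, show compressedAvg ρ σ Q P = 0 from LinearMap.ext h, map_zero]
  have hfix (Y : Matrix n n K) (hY : ∀ g, σ g * Y = Y * σ g) (hPY : P * (Y * P) = Y) :
      compressedAvg σ σ P P Y = (Fintype.card G : K) • Y := by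
    rw [compressedAvg_apply, hPY, avg_of_intertwines hσ hY]
  set Φ := (Fintype.card G : K)⁻¹ • compressedAvg σ σ P P with hΦ
  have hid : IsIdempotentElem Φ := by
    refine LinearMap.ext fun X => ?_
    have := hfix (compressedAvg σ σ P P X) (avg_intertwines hσ hσm hσm _)
      (by rw [compressedAvg_mul hσ hP hPσ, mul_compressedAvg hP hPσ])
    simp [hΦ, this, smul_smul, hc]
  have hΦP : Φ P = P := by
    have := hfix P hPσ (by rw [hP, hP])
    simp [hΦ, this, smul_smul, hc]
  have htrΦ : LinearMap.trace K _ Φ = 0 := by simp [hΦ, h0]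
  have hr := (LinearMap.IsIdempotentElem.isProj_range Φ hid).trace
  rw [htrΦ] at hr
  have hr' : LinearMap.range Φ = ⊥ := Submodule.finrank_eq_zero.1 (by exact_mod_cast hr.symm)
  apply hP0
  rw [← hΦP, LinearMap.range_eq_bot.1 hr', LinearMap.zero_apply]

/-- Two projective representations with the same multiplier and the same character are linearly
equivalent in characteristic zero. -/
theorem exists_isUnit_intertwines [CharZero K] [Group G] {α : G → G → K}
    {ρ σ : G → Matrix n n K} (hρ : ∀ g, IsUnit (ρ g))
    (hσ : ∀ g, IsUnit (σ g)) (hρm : ∀ g h, ρ g * ρ h = α g h • ρ (g * h))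
    (hσm : ∀ g h, σ g * σ h = α g h • σ (g * h)) (htr : ∀ g, (ρ g).trace = (σ g).trace) :
    ∃ T : Matrix n n K, IsUnit T ∧ ∀ g, ρ g * T = T * σ g := by
  have hc : (Fintype.card G : K) ≠ 0 := Nat.cast_ne_zero.2 Fintype.card_ne_zero
  obtain ⟨_, ⟨T, hT, rfl⟩, hmin⟩ := (wellFounded_lt (α := Submodule K (n → K))).has_min
    ((fun T : Matrix n n K => LinearMap.ker T.mulVecLin) '' {T | ∀ g, ρ g * T = T * σ g})
    ⟨_, 0, by simp, rfl⟩
  refine ⟨T, ?_, hT⟩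
  obtain ⟨R₀, hR₀⟩ := exists_mul_mul_eq_self T
  obtain ⟨R, hRσ, hR⟩ : ∃ R, (∀ g, σ g * R = R * ρ g) ∧ T * R * T = T := by
    refine ⟨(Fintype.card G : K)⁻¹ • avg σ ρ R₀, fun g => ?_, ?_⟩
    · rw [Matrix.mul_smul, Matrix.smul_mul, avg_intertwines hρ hσm hρm]
    · have hav : T * avg σ ρ R₀ * T = (Fintype.card G : K) • T := by
        rw [avg_apply, Finset.mul_sum, Finset.sum_mul, ← avg_of_intertwines hσ hT, avg_apply]
        refine Finset.sum_congr rfl fun g _ => ?_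
        have hTi : (ρ g)⁻¹ * T = T * (σ g)⁻¹ :=
          nonsing_inv_mul_comm_of_intertwines (hρ g) (hσ g) (hT g)
        calc T * (σ g * R₀ * (ρ g)⁻¹) * T = (T * σ g) * R₀ * ((ρ g)⁻¹ * T) := by
              simp only [Matrix.mul_assoc]
          _ = ρ g * (T * R₀ * T) * (σ g)⁻¹ := by
              rw [hTi, ← hT]; simp only [Matrix.mul_assoc]
          _ = _ := by rw [hR₀]
      rw [Matrix.mul_smul, Matrix.smul_mul, hav, smul_smul, inv_mul_cancel₀ hc, one_smul]
  by_cases hP0 : 1 - R * T = 0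
  · exact IsUnit.of_mul_eq_one_right R (sub_eq_zero.1 hP0).symm
  exfalso
  have hTP : T * (1 - R * T) = 0 := by
    rw [Matrix.mul_sub, Matrix.mul_one, ← Matrix.mul_assoc, hR, sub_self]
  have hQT : (1 - T * R) * T = 0 := by rw [Matrix.sub_mul, Matrix.one_mul, hR, sub_self]
  have hPP : (1 - R * T) * (1 - R * T) = 1 - R * T := by
    rw [Matrix.sub_mul, Matrix.one_mul, Matrix.mul_assoc, hTP, Matrix.mul_zero, sub_zero]
  have hQQ : (1 - T * R) * (1 - T * R) = 1 - T * R := by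
    rw [Matrix.mul_sub, Matrix.mul_one, ← Matrix.mul_assoc, hQT, Matrix.zero_mul, sub_zero]
  have hPσ (g : G) : σ g * (1 - R * T) = (1 - R * T) * σ g := by
    rw [Matrix.mul_sub, Matrix.sub_mul, ← Matrix.mul_assoc, hRσ, Matrix.mul_assoc, hT,
      Matrix.mul_assoc, Matrix.mul_one, Matrix.one_mul]
  have hQρ (g : G) : ρ g * (1 - T * R) = (1 - T * R) * ρ g := by
    rw [Matrix.mul_sub, Matrix.sub_mul, ← Matrix.mul_assoc, hT, Matrix.mul_assoc, hRσ,
      Matrix.mul_assoc, Matrix.mul_one, Matrix.one_mul]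
  obtain ⟨X, hX⟩ := exists_compressedAvg_ne_zero (ρ := ρ) (Q := 1 - T * R) hσ hσm hPP hPσ
    (fun g => by
      rw [Matrix.mul_sub, Matrix.mul_sub, Matrix.trace_sub, Matrix.trace_sub, Matrix.mul_one,
        Matrix.mul_one, htr, ← Matrix.mul_assoc, hT, Matrix.mul_assoc, Matrix.trace_mul_comm,
        Matrix.mul_assoc]) hP0
  set Y := compressedAvg ρ σ (1 - T * R) (1 - R * T) X with hYdef
  have hQY : (1 - T * R) * Y = Y := mul_compressedAvg hQQ hQρ X
  obtain ⟨w, hw⟩ : ∃ w, Y *ᵥ w ≠ 0 := by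
    by_contra! h
    exact hX (Matrix.mulVec_injective (funext fun w => by rw [h, Matrix.zero_mulVec]))
  have hYP : Y * (1 - R * T) = Y := compressedAvg_mul hσ hPP hPσ X
  refine hmin _ ⟨T + Y, fun g => ?_, rfl⟩ (SetLike.lt_iff_le_and_exists.2
    ⟨fun v hv => ?_, (1 - R * T) *ᵥ w, ?_, ?_⟩)
  · rw [Matrix.mul_add, Matrix.add_mul, hT, hYdef, compressedAvg_apply,
      avg_intertwines hσ hρm hσm]
  · have hv' : (T + Y) *ᵥ v = 0 := hv
    have hYv : Y *ᵥ v = 0 := by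
      have := congrArg ((1 - T * R) *ᵥ ·) hv'
      simpa only [Matrix.mulVec_mulVec, Matrix.mul_add, hQT, hQY, zero_add,
        Matrix.mulVec_zero] using this
    rw [Matrix.add_mulVec, hYv, add_zero] at hv'
    exact hv'
  · rw [LinearMap.mem_ker, Matrix.mulVecLin_apply, Matrix.mulVec_mulVec, hTP, Matrix.zero_mulVec]
  · rw [LinearMap.mem_ker, Matrix.mulVecLin_apply, Matrix.mulVec_mulVec, Matrix.add_mul, hTP,
      hYP, zero_add]
    exact hw

end Average

end Matrix

section Lreg

variable {G : Type*} [Group G] [DecidableEq G] {α : G → G → ℂ}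

theorem Lreg_mul_Lreg [Fintype G]
    (hcoc : ∀ g h k, α g h * α (g * h) k = α g (h * k) * α h k) (g h : G) :
    Lreg α g * Lreg α h = α g h • Lreg α (g * h) := by
  ext a k
  simp [Matrix.mul_apply, Lreg, mul_assoc, hcoc]

theorem Lreg_one (hnorm : ∀ g, α 1 g = 1) : Lreg α 1 = 1 := by
  ext a b
  simp [Lreg, Matrix.one_apply, hnorm]

theorem isUnit_Lreg [Fintype G] (hα : ∀ g h, α g h ≠ 0)
    (hcoc : ∀ g h k, α g h * α (g * h) k = α g (h * k) * α h k) (hnorm : ∀ g, α 1 g = 1) (g : G) :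
    IsUnit (Lreg α g) := by
  refine IsUnit.of_mul_eq_one ((α g g⁻¹)⁻¹ • Lreg α g⁻¹) ?_
  rw [Matrix.mul_smul, Lreg_mul_Lreg hcoc, smul_smul, inv_mul_cancel₀ (hα _ _), one_smul,
    mul_inv_cancel, Lreg_one hnorm]

theorem trace_Lreg [Fintype G] (hnorm : ∀ g, α 1 g = 1) (g : G) :
    (Lreg α g).trace = if g = 1 then (Fintype.card G : ℂ) else 0 := by
  split_ifs with h
  · rw [h, Lreg_one hnorm, Matrix.trace_one]
  · simp [Matrix.trace, Lreg, h]

end Lreg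

/-- For a finite group `G`, a normalized unitary 2-cocycle `α` on `G`, and a
unitary `α`-projective representation `λ` of degree `|G|` whose character is `|G|` at the
identity and `0` elsewhere, `λ` is linearly equivalent to the left regular `α`-projective
representation. -/
theorem regular_character_implies_equivalent_to_left_regular
    {G : Type*} [Group G] [Fintype G] [DecidableEq G]
    (α : G → G → ℂ)
    (hunit : ∀ g h, ‖α g h‖ = 1)
    (hnorm : ∀ g, α g 1 = 1 ∧ α 1 g = 1)
    (hcoc : ∀ g h k, α g h * α (g * h) k = α g (h * k) * α h k)
    (lam : G → Matrix G G ℂ)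
    (hU : ∀ g, lam g * (lam g)ᴴ = 1)
    (hproj : ∀ g h, lam g * lam h = α g h • lam (g * h))
    (htr : ∀ g : G, (lam g).trace = if g = 1 then (Fintype.card G : ℂ) else 0) :
    ∃ S : Matrix G G ℂ, IsUnit S ∧ ∀ g : G, lam g = S⁻¹ * Lreg α g * S := by
  have hα (g h : G) : α g h ≠ 0 := fun h0 => by simpa [h0] using hunit g h
  obtain ⟨T, hTu, hT⟩ := Matrix.exists_isUnit_intertwines
    (fun g => IsUnit.of_mul_eq_one _ (hU g)) (isUnit_Lreg hα hcoc fun g => (hnorm g).2)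
    hproj (Lreg_mul_Lreg hcoc) (fun g => by rw [htr, trace_Lreg fun g => (hnorm g).2])
  have hd := (Matrix.isUnit_iff_isUnit_det _).1 hTu
  refine ⟨T⁻¹, (Matrix.isUnit_nonsing_inv_iff).2 hTu, fun g => ?_⟩
  rw [Matrix.nonsing_inv_nonsing_inv _ hd, ← hT, Matrix.mul_assoc, Matrix.mul_nonsing_inv _ hd,
    Matrix.mul_one]
end

section
/- Let G be a finite group, let τ and α be normalized unitary 2-cocycles on G, let τ̄ denote the pointwise complex conjugate of τ, and let V be a unitary α-projective representation of G of degree d. Define the invertible operator S := Σ_{g∈G} |g⟩⟨g| ⊗ V(g) on ℂG ⊗ ℂ^d, and define the 2-cocycle (ατ̄)(g,h) := α(g,h)/τ(g,h). Then for all g ∈ G: S·(R^{τ̄}(g) ⊗ V(g))·S⁻¹ = R^{ατ̄}(g) ⊗ I_d. -/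
open Matrix Kronecker

/-- The right regular `τ`-projective representation of a finite group `G`, acting on `ℂG`:
`(R^τ g) h h'' = τ h g` if `h'' = h * g` and `0` otherwise. -/
def Rreg {G : Type*} [Group G] [DecidableEq G] (τ : G → G → ℂ) (g : G) :
    Matrix G G ℂ :=
  fun h h'' => if h'' = h * g then τ h g else 0

lemma sum_single_kronecker_apply {G n R : Type*} [Fintype G] [DecidableEq G] [Semiring R]
    (V : G → Matrix n n R) (p q : G × n) :
    (∑ x : G, Matrix.single x x (1 : R) ⊗ₖ V x) p q
      = if p.1 = q.1 then V p.1 p.2 q.2 else 0 := by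
  rw [Matrix.sum_apply]
  simp only [Matrix.kroneckerMap_apply, Matrix.single_apply, ite_mul, one_mul, zero_mul]
  split_ifs with h
  · simp [← h]
  · exact Finset.sum_eq_zero fun x _ => if_neg fun hx => h (hx.1.symm.trans hx.2)

lemma sum_single_kronecker_mul {G n R : Type*} [Fintype G] [DecidableEq G] [Fintype n]
    [CommSemiring R] (V W : G → Matrix n n R) :
    (∑ x : G, Matrix.single x x (1 : R) ⊗ₖ V x) * (∑ x : G, Matrix.single x x (1 : R) ⊗ₖ W x)
      = ∑ x : G, Matrix.single x x (1 : R) ⊗ₖ (V x * W x) := by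
  ext ⟨a, i⟩ ⟨b, j⟩
  rw [sum_single_kronecker_apply]
  simp only [Matrix.mul_apply, sum_single_kronecker_apply, Fintype.sum_prod_type]
  rw [Finset.sum_eq_single a (by intro c _ hc; simp [hc.symm]) (by simp)]
  by_cases h : a = b <;> simp [h]

lemma sum_single_kronecker_mul_Rreg {G n : Type*} [Group G] [Fintype G] [DecidableEq G]
    [Fintype n] [DecidableEq n] (σ ω : G → G → ℂ) (V : G → Matrix n n ℂ) (g : G)
    (hV : ∀ h, σ h g • (V h * V g) = ω h g • V (h * g)) :
    (∑ x : G, Matrix.single x x (1 : ℂ) ⊗ₖ V x) * (Rreg σ g ⊗ₖ V g)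
      = (Rreg ω g ⊗ₖ (1 : Matrix n n ℂ)) * (∑ x : G, Matrix.single x x (1 : ℂ) ⊗ₖ V x) := by
  ext ⟨a, i⟩ ⟨b, j⟩
  simp only [Matrix.mul_apply, sum_single_kronecker_apply, Fintype.sum_prod_type,
    Matrix.kroneckerMap_apply, Rreg]
  rw [Finset.sum_eq_single a (by intro c _ hc; simp [hc.symm]) (by simp),
    Finset.sum_eq_single (a * g) (by intro c _ hc; simp [hc]) (by simp)]
  by_cases h : b = a * g
  · subst h
    have := congrFun (congrFun (hV a) i) j
    simp only [Matrix.smul_apply, Matrix.mul_apply, smul_eq_mul, Finset.mul_sum] at this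
    simp only [if_true, Matrix.one_apply, mul_ite, mul_one, mul_zero, ite_mul, zero_mul,
      Finset.sum_ite_eq, Finset.mem_univ]
    rw [← this]
    exact Finset.sum_congr rfl fun x _ => by ring
  · simp [h, Ne.symm h]

/-- For a finite group `G`, normalized unitary 2-cocycles `τ` and `α` on `G`, and
a unitary `α`-projective representation `V` of degree `d`, the invertible operator
`S = Σ_g |g⟩⟨g| ⊗ V(g)` satisfies `S·(R^{τ̄}(g) ⊗ V(g))·S⁻¹ = R^{ατ̄}(g) ⊗ I_d` for all `g`,
where `τ̄` is the complex conjugate of `τ` and `(ατ̄)(g,h) = α(g,h)/τ(g,h)`. -/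
theorem conjugation_of_right_regular_by_controlled_V
    {G : Type*} [Group G] [Fintype G] [DecidableEq G]
    (τ α : G → G → ℂ)
    (hτunit : ∀ g h, ‖τ g h‖ = 1)
    (hτnorm : ∀ g, τ g 1 = 1 ∧ τ 1 g = 1)
    (hτcoc : ∀ g h k, τ g h * τ (g * h) k = τ g (h * k) * τ h k)
    (hαunit : ∀ g h, ‖α g h‖ = 1)
    (hαnorm : ∀ g, α g 1 = 1 ∧ α 1 g = 1)
    (hαcoc : ∀ g h k, α g h * α (g * h) k = α g (h * k) * α h k)
    (d : ℕ)
    (V : G → Matrix (Fin d) (Fin d) ℂ)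
    (hU : ∀ g, V g * (V g)ᴴ = 1)
    (hproj : ∀ g h, V g * V h = α g h • V (g * h)) :
    IsUnit (∑ g : G, Matrix.single g g (1 : ℂ) ⊗ₖ V g) ∧
    ∀ g : G,
      (∑ x : G, Matrix.single x x (1 : ℂ) ⊗ₖ V x)
          * (Rreg (fun a b => starRingEnd ℂ (τ a b)) g ⊗ₖ V g)
          * (∑ x : G, Matrix.single x x (1 : ℂ) ⊗ₖ V x)⁻¹
        = Rreg (fun a b => α a b / τ a b) g ⊗ₖ (1 : Matrix (Fin d) (Fin d) ℂ) := by
  have hS : (∑ x : G, Matrix.single x x (1 : ℂ) ⊗ₖ V x)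
      * (∑ x : G, Matrix.single x x (1 : ℂ) ⊗ₖ (V x)ᴴ) = 1 := by
    rw [sum_single_kronecker_mul]
    ext ⟨a, i⟩ ⟨b, j⟩
    rw [sum_single_kronecker_apply, hU]
    by_cases h : a = b <;> simp [h, Matrix.one_apply]
  have hunit : IsUnit (∑ x : G, Matrix.single x x (1 : ℂ) ⊗ₖ V x) :=
    IsUnit.of_mul_eq_one _ hS
  refine ⟨hunit, fun g => ?_⟩
  rw [sum_single_kronecker_mul_Rreg _ (fun a b => α a b / τ a b) V g fun h => ?_,
    Matrix.mul_assoc, Matrix.mul_nonsing_inv _ ((Matrix.isUnit_iff_isUnit_det _).1 hunit),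
    Matrix.mul_one]
  rw [hproj, smul_smul, ← Complex.inv_eq_conj (hτunit h g), div_eq_inv_mul]
end
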